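/- For every 1 < p < ∞ there exists λ0 > 0 such that for every λ ≥ λ0 there exists a constant C = C(λ) > 0 with the following property: for every real γ with 0 ≤ γ ≤ β and every u ∈ C_c^∞(ℝ^N; ℝ), ‖ |x|^γ u ‖_{L^p(ℝ^N)} ≤ C ‖ λu − Au ‖_{L^p(ℝ^N)}. -/

import Mathlib

open Real MeasureTheory Metric
open scoped ENNReal NNReal

/-- The `i`-th partial derivative of `u` at `x`. -/
noncomputable def pd {N : ℕ} {F : Type*} [NormedAddCommGroup F] [NormedSpace ℝ F]
    (u : EuclideanSpace ℝ (Fin N) → F) (i : Fin N) (x : EuclideanSpace ℝ (Fin N)) : F :=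
  fderiv ℝ u x (EuclideanSpace.single i 1)

/-- The Laplacian of `u` at `x`. -/
noncomputable def lap {N : ℕ} {F : Type*} [NormedAddCommGroup F] [NormedSpace ℝ F]
    (u : EuclideanSpace ℝ (Fin N) → F) (x : EuclideanSpace ℝ (Fin N)) : F :=
  ∑ i, pd (pd u i) i x

/-- The elliptic operator `Au = (1+|x|^α)Δu + b|x|^{α-2} x·∇u - c|x|^β u`. -/
noncomputable def opA {N : ℕ} (α β b c : ℝ) (u : EuclideanSpace ℝ (Fin N) → ℝ)
    (x : EuclideanSpace ℝ (Fin N)) : ℝ :=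
  (1 + ‖x‖ ^ α) * lap u x + b * ‖x‖ ^ (α - 2) * (∑ i, x i * pd u i x)
    - c * ‖x‖ ^ β * u x


theorem aux_alg1 (α b s r : ℝ) (hα : 2 < α) (hr : 0 ≤ r) :
    ((α - b) * r ^ (α - 2) + 2 * s * ((1 + r ^ α) / (1 + r ^ 2))) ^ 2 * r ^ 2 ≤
      (2 * (α - b) ^ 2 + 8 * s ^ 2) * (1 + r ^ α) * (1 + r ^ (α - 2)) := by
  have h1 : r ^ α = r ^ (α - 2) * r ^ 2 := by
    have := Real.rpow_add_of_nonneg hr (by linarith : 0 ≤ α - 2) (by norm_num : (0:ℝ) ≤ 2)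
    rw [sub_add_cancel] at this
    rw [this]; norm_num
  have hP : 0 ≤ r ^ (α - 2) := Real.rpow_nonneg hr _
  rw [h1]
  generalize r ^ (α - 2) = P at *
  have hq : 0 < 1 + r ^ 2 := by positivity
  obtain ⟨T, hT⟩ : ∃ T, T = (1 + P * r ^ 2) / (1 + r ^ 2) := ⟨_, rfl⟩
  rw [← hT]
  have hT1 : T * (1 + r ^ 2) = 1 + P * r ^ 2 := by rw [hT]; field_simp
  have hT0 : 0 ≤ T := by rw [hT]; positivity
  have hT2 : T ≤ 1 + P := by
    rw [hT, div_le_iff₀ hq]; nlinarith [sq_nonneg r]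
  have hA : 0 ≤ 1 + P * r ^ 2 := by positivity
  have e1 : P ^ 2 * r ^ 2 ≤ (1 + P * r ^ 2) * (1 + P) := by nlinarith [mul_nonneg hP (sq_nonneg r)]
  have e2 : T ^ 2 * r ^ 2 ≤ (1 + P * r ^ 2) * (1 + P) := by
    calc T ^ 2 * r ^ 2 ≤ T * (T * (1 + r ^ 2)) := by nlinarith [sq_nonneg T]
      _ = (1 + P * r ^ 2) * T := by rw [hT1]; ring
      _ ≤ _ := by gcongr
  have e3 : ((α - b) * P + 2 * s * T) ^ 2 ≤ 2 * (α - b) ^ 2 * P ^ 2 + 8 * s ^ 2 * T ^ 2 := by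
    nlinarith [sq_nonneg ((α - b) * P - 2 * s * T)]
  calc _ ≤ (2 * (α - b) ^ 2 * P ^ 2 + 8 * s ^ 2 * T ^ 2) * r ^ 2 := by gcongr
    _ = 2 * (α - b) ^ 2 * (P ^ 2 * r ^ 2) + 8 * s ^ 2 * (T ^ 2 * r ^ 2) := by ring
    _ ≤ 2 * (α - b) ^ 2 * ((1 + P * r ^ 2) * (1 + P)) + 8 * s ^ 2 * ((1 + P * r ^ 2) * (1 + P)) := by
      gcongr
    _ = _ := by ring

theorem aux_alg2 (μ β c K : ℝ) (hμ : 0 < μ) (hβ : μ < β) (hc : 0 < c) (hK : 0 ≤ K) :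
    ∃ δ : ℝ, 0 < δ ∧ ∃ lam0 : ℝ, 0 < lam0 ∧ ∀ r : ℝ, 0 ≤ r →
      δ * (1 + r ^ 2) ^ (β / 2) + K * (1 + r ^ μ) ≤ lam0 + c * r ^ β := by
  have h2 : (0:ℝ) < 2 ^ (β / 2) := by positivity
  refine ⟨c / (2 * 2 ^ (β / 2)), by positivity, ?_⟩
  set R : ℝ := (2 * K / c) ^ (1 / (β - μ)) with hR
  have hR0 : 0 ≤ R := by positivity
  refine ⟨c / 2 + K + K * R ^ μ, by positivity, fun r hr => ?_⟩
  have e1 : (1 + r ^ 2) ^ (β / 2) ≤ 2 ^ (β / 2) * (1 + r ^ β) := by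
    have hrb : 0 ≤ r ^ β := by positivity
    rcases le_total r 1 with h | h
    · calc (1 + r ^ 2) ^ (β / 2) ≤ 2 ^ (β / 2) := by
            apply Real.rpow_le_rpow (by positivity) (by nlinarith) (by linarith)
        _ ≤ _ := by nlinarith
    · calc (1 + r ^ 2) ^ (β / 2) ≤ (2 * r ^ 2) ^ (β / 2) := by
            apply Real.rpow_le_rpow (by positivity) (by nlinarith) (by linarith)
        _ = 2 ^ (β / 2) * r ^ β := by
            rw [Real.mul_rpow (by norm_num) (by positivity), ← Real.rpow_natCast_mul hr]
            congr 2; push_cast; ring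
        _ ≤ _ := by nlinarith
  have e2 : K * r ^ μ ≤ c / 2 * r ^ β + K * R ^ μ := by
    rcases le_total r R with h | h
    · have : r ^ μ ≤ R ^ μ := Real.rpow_le_rpow hr h hμ.le
      have h3 : 0 ≤ r ^ β := by positivity
      nlinarith [mul_le_mul_of_nonneg_left this hK]
    · have h3 : 2 * K / c ≤ r ^ (β - μ) := by
        calc 2 * K / c = R ^ (β - μ) := by
              rw [hR, ← Real.rpow_mul (by positivity), one_div_mul_cancel (by linarith), Real.rpow_one]
          _ ≤ _ := Real.rpow_le_rpow hR0 h (by linarith)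
      have h4 : r ^ β = r ^ (β - μ) * r ^ μ := by
        rw [← Real.rpow_add_of_nonneg hr (by linarith) hμ.le, sub_add_cancel]
      have h5 : K ≤ c / 2 * r ^ (β - μ) := by
        rw [div_le_iff₀ hc] at h3; linarith
      have h6 : 0 ≤ r ^ μ := by positivity
      have h7 : 0 ≤ K * R ^ μ := by positivity
      rw [h4]
      nlinarith [mul_le_mul_of_nonneg_right h5 h6]
  have e3 : c / (2 * 2 ^ (β / 2)) * (1 + r ^ 2) ^ (β / 2) ≤ c / 2 * (1 + r ^ β) := by
    calc _ ≤ c / (2 * 2 ^ (β / 2)) * (2 ^ (β / 2) * (1 + r ^ β)) := by gcongr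
      _ = _ := by field_simp
  linarith

theorem aux_core (m m' a K B Y H u r G S : ℝ) (hm : 0 < m) (hm' : m ≤ m') (ha : 0 < a)
    (hK : 0 ≤ K) (hB : 0 ≤ B) (hG : 0 ≤ G) (hS : S ^ 2 ≤ r ^ 2 * G)
    (hH : H ^ 2 * r ^ 2 ≤ K * a * B) (hY : K / (4 * m) * B ≤ Y) :
    0 ≤ Y * u ^ 2 + a * m' * G + H * (u * S) := by
  have h1 : (H * (u * S)) ^ 2 ≤ 4 * (a * m * G) * (K / (4 * m) * B * u ^ 2) := by
    calc (H * (u * S)) ^ 2 = H ^ 2 * u ^ 2 * S ^ 2 := by ring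
      _ ≤ H ^ 2 * u ^ 2 * (r ^ 2 * G) := by gcongr
      _ = (H ^ 2 * r ^ 2) * (u ^ 2 * G) := by ring
      _ ≤ (K * a * B) * (u ^ 2 * G) := by gcongr
      _ = _ := by field_simp
  have hX : 0 ≤ a * m * G := by positivity
  have hZ : 0 ≤ K / (4 * m) * B * u ^ 2 := by positivity
  have h2 : |H * (u * S)| ≤ a * m * G + K / (4 * m) * B * u ^ 2 := by
    apply abs_le_of_sq_le_sq _ (by positivity)
    nlinarith [sq_nonneg (a * m * G - K / (4 * m) * B * u ^ 2)]
  have h3 := (abs_le.1 h2).1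
  have h4 : K / (4 * m) * B * u ^ 2 ≤ Y * u ^ 2 := by gcongr
  have h5 : a * m * G ≤ a * m' * G := by gcongr
  linarith

theorem aux_young (δ q f g : ℝ) (hδ : 0 < δ) (hq : 1 < q) (hf : 0 ≤ f) (hg : 0 ≤ g) :
    f * g ^ (q - 1) - δ * g ^ q ≤ (2 / δ) ^ (q - 1) * f ^ q - δ / 2 * g ^ q := by
  have hgq : g ^ q = g * g ^ (q - 1) := by
    rw [← Real.rpow_one_add' hg (by linarith)]; congr 1; ring
  have hfq : f ^ q = f * f ^ (q - 1) := by
    rw [← Real.rpow_one_add' hf (by linarith)]; congr 1; ring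
  have h0 : 0 ≤ g ^ (q - 1) := by positivity
  have h0' : 0 ≤ f ^ (q - 1) := by positivity
  rcases le_total f (δ / 2 * g) with h | h
  · have : 0 ≤ (2 / δ) ^ (q - 1) * f ^ q := by positivity
    rw [hgq] at *
    nlinarith [mul_le_mul_of_nonneg_right h h0]
  · have h1 : g ≤ 2 / δ * f := by
      rw [div_mul_eq_mul_div, le_div_iff₀ hδ]; linarith
    have h2 : g ^ (q - 1) ≤ (2 / δ) ^ (q - 1) * f ^ (q - 1) := by
      rw [← Real.mul_rpow (by positivity) hf]
      exact Real.rpow_le_rpow hg h1 (by linarith)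
    have h3 : 0 ≤ g ^ q := by positivity
    have := mul_le_mul_of_nonneg_left h2 hf
    rw [hfq]
    nlinarith

theorem aux_div {N : ℕ} (F : EuclideanSpace ℝ (Fin N) → ℝ) (hF : ContDiff ℝ 1 F)
    (hs : HasCompactSupport F) (i : Fin N) :
    Integrable (fun x => pd F i x) volume ∧ ∫ x, pd F i x = 0 := by
  have hc : Continuous (fun x => pd F i x) :=
    (hF.continuous_fderiv (by norm_num)).clm_apply continuous_const
  have hcs : HasCompactSupport (fun x => pd F i x) := hs.fderiv_apply (𝕜 := ℝ) _
  have hi := hc.integrable_of_hasCompactSupport hcs (μ := volume)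
  refine ⟨hi, ?_⟩
  have := integral_mul_fderiv_eq_neg_fderiv_mul_of_integrable (μ := volume)
    (f := fun _ : EuclideanSpace ℝ (Fin N) => (1:ℝ)) (g := F) (v := EuclideanSpace.single i 1)
    (by simp) (by simpa [pd] using hi)
    (by simpa using hF.continuous.integrable_of_hasCompactSupport hs)
    (fun _ _ => by fun_prop) (fun x _ => hF.differentiable (by norm_num) x)
  simpa [pd] using this

/-- the vector field -/
noncomputable def vf {N : ℕ} (α s t ε : ℝ) (u : EuclideanSpace ℝ (Fin N) → ℝ) (i : Fin N)
    (x : EuclideanSpace ℝ (Fin N)) : ℝ :=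
  ((1 + ‖x‖ ^ α) * (1 + ‖x‖ ^ 2) ^ s) * (u x * (u x ^ 2 + ε) ^ t) * pd u i x

theorem pd_contDiff {N : ℕ} {u : EuclideanSpace ℝ (Fin N) → ℝ} (hu : ContDiff ℝ (⊤ : ℕ∞) u)
    (i : Fin N) : ContDiff ℝ (⊤ : ℕ∞) (pd u i) :=
  (hu.fderiv_right (m := (⊤ : ℕ∞)) (by simp)).clm_apply contDiff_const

theorem vf_contDiff {N : ℕ} (α s t ε : ℝ) (hα : 2 < α) (hε : 0 < ε)
    {u : EuclideanSpace ℝ (Fin N) → ℝ} (hu : ContDiff ℝ (⊤ : ℕ∞) u)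
    (i : Fin N) : ContDiff ℝ 1 (vf α s t ε u i) := by
  have h1 : ContDiff ℝ 1 u := hu.of_le (by exact_mod_cast le_top)
  have h2 : ContDiff ℝ 1 (pd u i) := (pd_contDiff hu i).of_le (by exact_mod_cast le_top)
  unfold vf
  refine ((ContDiff.mul (contDiff_const.add (contDiff_norm_rpow (by linarith))) ?_).mul
    (h1.mul ?_)).mul h2
  · exact (contDiff_const.add (contDiff_norm_sq ℝ)).rpow_const_of_ne (fun x => by positivity)
  · exact ((h1.pow 2).add contDiff_const).rpow_const_of_ne (fun x => by positivity)

theorem vf_pd {N : ℕ} (α s t ε : ℝ) (hα : 2 < α) (hε : 0 < ε)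
    {u : EuclideanSpace ℝ (Fin N) → ℝ} (hu : ContDiff ℝ (⊤ : ℕ∞) u)
    (i : Fin N) (x : EuclideanSpace ℝ (Fin N)) : pd (vf α s t ε u i) i x =
      (1 + ‖x‖ ^ 2) ^ s * (u x ^ 2 + ε) ^ t * (
        (α * ‖x‖ ^ (α - 2) + 2 * s * ((1 + ‖x‖ ^ α) / (1 + ‖x‖ ^ 2))) * (u x * (x i * pd u i x))
        + (1 + ‖x‖ ^ α) * (1 + 2 * t * (u x ^ 2 / (u x ^ 2 + ε))) * pd u i x ^ 2
        + (1 + ‖x‖ ^ α) * (u x * pd (pd u i) i x)) := by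
  have ha := (hasFDerivAt_norm_rpow x (by linarith : 1 < α)).const_add 1
  have hw := ((hasStrictFDerivAt_norm_sq x).hasFDerivAt.const_add 1).rpow_const (p := s)
    (Or.inl (by positivity))
  have hu' : HasFDerivAt u (fderiv ℝ u x) x := (hu.differentiable (by simp) x).hasFDerivAt
  have hψ := ((hu'.pow 2).add_const ε).rpow_const (p := t) (Or.inl (by positivity))
  have hp : HasFDerivAt (pd u i) (fderiv ℝ (pd u i) x) x :=
    ((pd_contDiff hu i).differentiable (by simp) x).hasFDerivAt
  have h := ((ha.mul hw).mul (hu'.mul hψ)).mul hp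
  have hq : (0:ℝ) < 1 + ‖x‖ ^ 2 := by positivity
  have hq' : (0:ℝ) < u x ^ 2 + ε := by positivity
  have e1 : (1 + ‖x‖ ^ 2) ^ (s - 1) = (1 + ‖x‖ ^ 2) ^ s / (1 + ‖x‖ ^ 2) := Real.rpow_sub_one hq.ne' _
  have e2 : (u x ^ 2 + ε) ^ (t - 1) = (u x ^ 2 + ε) ^ t / (u x ^ 2 + ε) := Real.rpow_sub_one hq'.ne' _
  have h' : fderiv ℝ (vf α s t ε u i) x = _ := h.fderiv
  conv_lhs => unfold pd
  rw [h']
  simp only [e1, e2]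
  have e3 : inner ℝ x (EuclideanSpace.single i (1:ℝ)) = x i := by
    simp [EuclideanSpace.inner_single_right]
  have e4 : ∀ v : EuclideanSpace ℝ (Fin N) → ℝ, fderiv ℝ v x (EuclideanSpace.single i 1) = pd v i x :=
    fun v => rfl
  simp only [add_apply, smul_apply, smul_eq_mul,
    innerSL_apply_apply, e3, e4, nsmul_eq_mul, Pi.mul_apply]
  push_cast
  field_simp
  ring

theorem w_cont {N : ℕ} (s : ℝ) :
    Continuous (fun x : EuclideanSpace ℝ (Fin N) => (1 + ‖x‖ ^ 2) ^ s) := by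
  have h : ∀ x : EuclideanSpace ℝ (Fin N), 1 + ‖x‖ ^ 2 ≠ 0 := fun x => by positivity
  exact (continuous_const.add (continuous_norm.pow 2)).rpow_const (fun x => Or.inl (h x))

theorem psi_cont {N : ℕ} {u : EuclideanSpace ℝ (Fin N) → ℝ} (hu : Continuous u) (ε t : ℝ)
    (hε : 0 < ε) : Continuous (fun x => (u x ^ 2 + ε) ^ t) := by
  have h : ∀ x, u x ^ 2 + ε ≠ 0 := fun x => by positivity
  exact ((hu.pow 2).add continuous_const).rpow_const (fun x => Or.inl (h x))

theorem opA_cont {N : ℕ} (α β b c : ℝ) (hα : 2 < α) (hβ : 0 < β)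
    {u : EuclideanSpace ℝ (Fin N) → ℝ} (hu : ContDiff ℝ (⊤ : ℕ∞) u) :
    Continuous (fun x => opA α β b c u x) := by
  have h1 : ∀ i, Continuous (pd u i) := fun i => (pd_contDiff hu i).continuous
  have h2 : ∀ i, Continuous (pd (pd u i) i) := fun i => (pd_contDiff (pd_contDiff hu i) i).continuous
  have h0 := hu.continuous
  have n1 : ∀ a : ℝ, 0 ≤ a → Continuous (fun x : EuclideanSpace ℝ (Fin N) => ‖x‖ ^ a) :=
    fun a ha => continuous_norm.rpow_const (fun _ => Or.inr ha)
  have m1 := n1 α (by linarith)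
  have m2 := n1 (α - 2) (by linarith)
  have m3 := n1 β hβ.le
  unfold opA lap
  refine (((continuous_const.add m1).mul (continuous_finsetSum _ fun i _ => h2 i)).add
    ((continuous_const.mul m2).mul (continuous_finsetSum _ fun i _ => Continuous.mul ?_ (h1 i)))).sub
    ((continuous_const.mul m3).mul h0)
  exact (EuclideanSpace.proj (𝕜 := ℝ) i).continuous

theorem opA_supp {N : ℕ} (α β b c lam : ℝ)
    {u : EuclideanSpace ℝ (Fin N) → ℝ} (hs : HasCompactSupport u) :
    HasCompactSupport (fun x => lam * u x - opA α β b c u x) := by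
  refine hs.of_isClosed_subset (isClosed_tsupport _) ?_
  refine closure_minimal ?_ (isClosed_tsupport _)
  intro x hx
  by_contra hn
  apply hx
  have h1 : ∀ v : EuclideanSpace ℝ (Fin N) → ℝ, tsupport v ⊆ tsupport u → ∀ i,
      tsupport (pd v i) ⊆ tsupport u := fun v hv i =>
    (tsupport_fderiv_apply_subset ℝ (EuclideanSpace.single i (1:ℝ))).trans hv
  have z0 : u x = 0 := image_eq_zero_of_notMem_tsupport hn
  have z1 : ∀ i, pd u i x = 0 := fun i =>
    image_eq_zero_of_notMem_tsupport (fun h => hn (h1 u le_rfl i h))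
  have z2 : ∀ i, pd (pd u i) i x = 0 := fun i =>
    image_eq_zero_of_notMem_tsupport (fun h => hn (h1 _ (h1 u le_rfl i) i h))
  simp [opA, lap, z0, z1, z2]

theorem aux_eps {N : ℕ} (α β b c q δ lam s ε : ℝ) (hα : 2 < α) (hβ : 0 < β) (hq : 1 < q)
    (hε : 0 < ε)
    (hlam : ∀ r : ℝ, 0 ≤ r → δ * (1 + r ^ 2) ^ (β / 2) +
      (2 * (α - b) ^ 2 + 8 * s ^ 2) / (4 * min 1 (q - 1)) * (1 + r ^ (α - 2)) ≤ lam + c * r ^ β)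
    {u : EuclideanSpace ℝ (Fin N) → ℝ} (hu : ContDiff ℝ (⊤ : ℕ∞) u) (hs : HasCompactSupport u) :
    0 ≤ ∫ x, ((lam * u x - opA α β b c u x) - δ * (1 + ‖x‖ ^ 2) ^ (β / 2) * u x) *
      (1 + ‖x‖ ^ 2) ^ s * (u x * (u x ^ 2 + ε) ^ ((q - 2) / 2)) := by
  set t := (q - 2) / 2 with ht
  have hvs : ∀ i, HasCompactSupport (vf α s t ε u i) := fun i => by
    have : vf α s t ε u i = (fun x => u x * (((1 + ‖x‖ ^ α) * (1 + ‖x‖ ^ 2) ^ s) *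
      ((u x ^ 2 + ε) ^ t) * pd u i x)) := by
      funext x; unfold vf; ring
    rw [this]
    exact hs.mul_right
  have hd := fun i => aux_div _ (vf_contDiff α s t ε hα hε hu i) (hvs i) i
  have hsum : ∫ x, ∑ i, pd (vf α s t ε u i) i x = 0 := by
    rw [integral_finsetSum _ (fun i _ => (hd i).1)]
    exact Finset.sum_eq_zero (fun i _ => (hd i).2)
  have hsi : Integrable (fun x => ∑ i, pd (vf α s t ε u i) i x) volume :=
    integrable_finsetSum _ (fun i _ => (hd i).1)
  have hneg : ∫ x, -∑ i, pd (vf α s t ε u i) i x = 0 := by rw [integral_neg, hsum, neg_zero]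
  rw [← hneg]
  have hoc := opA_cont α β b c hα hβ hu
  have hu0 := hu.continuous
  have hw : ∀ s : ℝ, Continuous (fun x : EuclideanSpace ℝ (Fin N) => (1 + ‖x‖ ^ 2) ^ s) := w_cont
  have hw1 := hw s
  have hw2 := hw (β / 2)
  have hψ : Continuous (fun x => (u x ^ 2 + ε) ^ t) :=
    psi_cont hu0 ε t hε
  apply integral_mono hsi.neg
  · apply Continuous.integrable_of_hasCompactSupport
    · exact ((((continuous_const.mul hu0).sub hoc).sub ((continuous_const.mul hw2).mul hu0)).mul
        hw1).mul (hu0.mul hψ)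
    · exact HasCompactSupport.mul_left (hs.mul_right)
  intro x
  have hwp : 0 < (1 + ‖x‖ ^ 2) ^ s := by positivity
  have hψp : 0 < (u x ^ 2 + ε) ^ t := by positivity
  have hr : 0 ≤ ‖x‖ := norm_nonneg x
  have hm : 0 < min 1 (q - 1) := lt_min one_pos (by linarith)
  have hue : 0 < u x ^ 2 + ε := by positivity
  have hm' : min 1 (q - 1) ≤ 1 + 2 * t * (u x ^ 2 / (u x ^ 2 + ε)) := by
    have k1 : u x ^ 2 / (u x ^ 2 + ε) ≤ 1 := by rw [div_le_one hue]; linarith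
    have k0 : 0 ≤ u x ^ 2 / (u x ^ 2 + ε) := by positivity
    have k2 : 2 * t = q - 2 := by rw [ht]; ring
    rw [k2]
    rcases le_total q 2 with h | h
    · exact (min_le_right _ _).trans (by nlinarith)
    · exact (min_le_left _ _).trans (by nlinarith)
  have hS : (∑ i, x i * pd u i x) ^ 2 ≤ ‖x‖ ^ 2 * ∑ i, pd u i x ^ 2 := by
    have := Finset.sum_mul_sq_le_sq_mul_sq Finset.univ (fun i => x i) (fun i => pd u i x)
    rw [EuclideanSpace.norm_sq_eq]
    simpa using this
  have hP : 0 ≤ ‖x‖ ^ (α - 2) := by positivity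
  have hcore := aux_core (min 1 (q - 1)) (1 + 2 * t * (u x ^ 2 / (u x ^ 2 + ε))) (1 + ‖x‖ ^ α)
    (2 * (α - b) ^ 2 + 8 * s ^ 2) (1 + ‖x‖ ^ (α - 2))
    (lam + c * ‖x‖ ^ β - δ * (1 + ‖x‖ ^ 2) ^ (β / 2)) _ (u x) ‖x‖ (∑ i, pd u i x ^ 2)
    (∑ i, x i * pd u i x) hm hm' (by positivity) (by positivity) (by positivity)
    (Finset.sum_nonneg fun i _ => sq_nonneg _) hS (aux_alg1 α b s ‖x‖ hα hr)
    (by linarith [hlam ‖x‖ hr])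
  have hdiv : ∑ i, pd (vf α s t ε u i) i x = (1 + ‖x‖ ^ 2) ^ s * (u x ^ 2 + ε) ^ t * (
        (α * ‖x‖ ^ (α - 2) + 2 * s * ((1 + ‖x‖ ^ α) / (1 + ‖x‖ ^ 2))) * (u x * ∑ i, x i * pd u i x)
        + (1 + ‖x‖ ^ α) * (1 + 2 * t * (u x ^ 2 / (u x ^ 2 + ε))) * (∑ i, pd u i x ^ 2)
        + (1 + ‖x‖ ^ α) * (u x * lap u x)) := by
    simp only [vf_pd α s t ε hα hε hu, lap, Finset.mul_sum, ← Finset.sum_add_distrib]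
  have := mul_nonneg (mul_nonneg hwp.le hψp.le) hcore
  rw [← sub_nonneg]
  simp only [Pi.neg_apply]
  rw [hdiv]
  unfold opA
  convert this using 1
  ring

theorem aux_lim {N : ℕ} (q : ℝ) (hq : 1 < q)
    {u h : EuclideanSpace ℝ (Fin N) → ℝ} (hu : Continuous u) (hh : Continuous h)
    (hs : HasCompactSupport h)
    (H : ∀ ε : ℝ, 0 < ε → 0 ≤ ∫ x, h x * (u x * (u x ^ 2 + ε) ^ ((q - 2) / 2))) :
    Integrable (fun x => h x * (u x * (u x ^ 2) ^ ((q - 2) / 2))) volume ∧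
    0 ≤ ∫ x, h x * (u x * (u x ^ 2) ^ ((q - 2) / 2)) := by
  have hcont : Continuous (fun x => u x * (u x ^ 2) ^ ((q - 2) / 2)) := by
    have e : ∀ v : ℝ, v * (v ^ 2) ^ ((q - 2) / 2) = SignType.sign v * |v| ^ (q - 1) := by
      intro v
      by_cases hv : v = 0
      · simp [hv]
      have hav : 0 < |v| := abs_pos.2 hv
      have e1 : (v ^ 2) ^ ((q - 2) / 2) = |v| ^ (q - 2) := by
        rw [← sq_abs, ← Real.rpow_natCast_mul hav.le]; congr 1; push_cast; ring
      have e2 : |v| ^ (q - 1) = |v| * |v| ^ (q - 2) := by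
        rw [← Real.rpow_one_add' hav.le (by linarith)]; congr 1; ring
      rw [e1, e2, ← mul_assoc, sign_mul_abs]
    have hc : Continuous (fun v : ℝ => v * (v ^ 2) ^ ((q - 2) / 2)) := by
      rw [continuous_iff_continuousAt]
      intro v
      by_cases hv : v = 0
      · subst hv
        unfold ContinuousAt
        simp only [zero_mul]
        apply squeeze_zero_norm (a := fun v : ℝ => |v| ^ (q - 1))
        · intro v
          rw [e, norm_mul, Real.norm_eq_abs (|v| ^ (q - 1)), abs_of_nonneg (by positivity)]
          refine mul_le_of_le_one_left (by positivity) ?_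
          rcases lt_trichotomy v 0 with h | h | h <;> simp [h]
        · have : Continuous (fun v : ℝ => |v| ^ (q - 1)) :=
            continuous_abs.rpow_const (fun _ => Or.inr (by linarith))
          simpa [(by linarith : q - 1 ≠ 0)] using this.tendsto 0
      · exact continuousAt_id.mul ((continuousAt_id.pow 2).rpow_const (Or.inl (pow_ne_zero 2 hv)))
    exact hc.comp hu
  refine ⟨(hh.mul hcont).integrable_of_hasCompactSupport (HasCompactSupport.mul_right hs), ?_⟩
  have hlim : Filter.Tendsto (fun n : ℕ => ∫ x, h x * (u x * (u x ^ 2 + 1 / ((n:ℝ) + 1)) ^ ((q - 2) / 2)))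
      Filter.atTop (nhds (∫ x, h x * (u x * (u x ^ 2) ^ ((q - 2) / 2)))) := by
    apply tendsto_integral_of_dominated_convergence (fun x => |h x| * (u x ^ 2 + 1) ^ ((q - 1) / 2))
    · intro n
      apply Continuous.aestronglyMeasurable
      have : Continuous (fun x => (u x ^ 2 + 1 / ((n:ℝ) + 1)) ^ ((q - 2) / 2)) :=
        psi_cont hu _ _ (by positivity)
      exact hh.mul (hu.mul this)
    · apply Continuous.integrable_of_hasCompactSupport
      · have : Continuous (fun x => (u x ^ 2 + 1) ^ ((q - 1) / 2)) :=
          psi_cont hu _ _ (by positivity)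
        exact hh.abs.mul this
      · exact HasCompactSupport.mul_right (hs.norm)
    · intro n
      refine Filter.Eventually.of_forall fun x => ?_
      have hn : (0:ℝ) < 1 / ((n:ℝ) + 1) := by positivity
      have hn1 : 1 / ((n:ℝ) + 1) ≤ 1 := by
        rw [div_le_one (by positivity)]; linarith [(Nat.cast_nonneg n : (0:ℝ) ≤ n)]
      generalize 1 / ((n:ℝ) + 1) = ε at *
      have hp : 0 < u x ^ 2 + ε := by positivity
      rw [Real.norm_eq_abs, abs_mul, abs_mul]
      gcongr
      rw [abs_of_pos (Real.rpow_pos_of_pos hp _)]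
      have : |u x| ≤ (u x ^ 2 + ε) ^ ((1:ℝ) / 2) := by
        rw [← Real.sqrt_eq_rpow]
        apply Real.abs_le_sqrt; linarith
      calc |u x| * (u x ^ 2 + ε) ^ ((q - 2) / 2)
          ≤ (u x ^ 2 + ε) ^ ((1:ℝ) / 2) * (u x ^ 2 + ε) ^ ((q - 2) / 2) := by gcongr
        _ = (u x ^ 2 + ε) ^ ((q - 1) / 2) := by rw [← Real.rpow_add hp]; congr 1; ring
        _ ≤ _ := Real.rpow_le_rpow hp.le (by linarith) (by linarith)
    · refine Filter.Eventually.of_forall fun x => ?_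
      by_cases hx : u x = 0
      · simp [hx]
      · have h0 : u x ^ 2 ≠ 0 := pow_ne_zero _ hx
        refine Filter.Tendsto.const_mul _ (Filter.Tendsto.const_mul _ ?_)
        have h1 : Filter.Tendsto (fun n : ℕ => u x ^ 2 + 1 / ((n:ℝ) + 1)) Filter.atTop
            (nhds (u x ^ 2)) := by
          simpa using (tendsto_one_div_add_atTop_nhds_zero_nat (𝕜 := ℝ)).const_add (u x ^ 2)
        exact h1.rpow_const (Or.inl h0)
  exact ge_of_tendsto' hlim (fun n => H _ (by positivity))

set_option maxHeartbeats 2000000 in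
theorem aux_main {N : ℕ} (α β b c q δ lam : ℝ) (hα : 2 < α) (hβ : 0 < β) (hq : 1 < q)
    (hδ : 0 < δ)
    (hlam : ∀ r : ℝ, 0 ≤ r → δ * (1 + r ^ 2) ^ (β / 2) +
      (2 * (α - b) ^ 2 + 8 * (β / 2 * (q - 1)) ^ 2) / (4 * min 1 (q - 1)) * (1 + r ^ (α - 2))
        ≤ lam + c * r ^ β)
    {u : EuclideanSpace ℝ (Fin N) → ℝ} (hu : ContDiff ℝ (⊤ : ℕ∞) u) (hs : HasCompactSupport u) :
    ∫ x, ‖(1 + ‖x‖ ^ 2) ^ (β / 2) * u x‖ ^ q ≤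
      (2 / δ) ^ q * ∫ x, ‖lam * u x - opA α β b c u x‖ ^ q := by
  have hq0 : 0 < q := by linarith
  have hu0 := hu.continuous
  have hw : ∀ s : ℝ, Continuous (fun x : EuclideanSpace ℝ (Fin N) => (1 + ‖x‖ ^ 2) ^ s) := w_cont
  have hw1 := hw (β / 2 * (q - 1))
  have hw2 := hw (β / 2)
  have hoc := opA_cont α β b c hα hβ hu
  have hfc : Continuous (fun x => lam * u x - opA α β b c u x) :=
    (continuous_const.mul hu0).sub hoc
  have hfs := opA_supp α β b c lam hs
  have hgs : HasCompactSupport (fun x => δ * (1 + ‖x‖ ^ 2) ^ (β / 2) * u x) := hs.mul_left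
  have hgs' : HasCompactSupport (fun x => (1 + ‖x‖ ^ 2) ^ (β / 2) * u x) := hs.mul_left
  have hrp : ∀ v : EuclideanSpace ℝ (Fin N) → ℝ, Continuous v → HasCompactSupport v →
      Integrable (fun x => ‖v x‖ ^ q) volume := fun v hv hvs => by
    apply Continuous.integrable_of_hasCompactSupport
    · exact hv.norm.rpow_const (fun _ => Or.inr hq0.le)
    · exact hvs.comp_left (g := fun y => ‖y‖ ^ q) (by simp [hq0.ne'])
  have hfi := hrp _ hfc hfs
  have hgi := hrp (fun x => (1 + ‖x‖ ^ 2) ^ (β / 2) * u x) (hw2.mul hu0) hgs'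
  have hhc : Continuous (fun x => ((lam * u x - opA α β b c u x) -
      δ * (1 + ‖x‖ ^ 2) ^ (β / 2) * u x) * (1 + ‖x‖ ^ 2) ^ (β / 2 * (q - 1))) :=
    (hfc.sub ((continuous_const.mul hw2).mul hu0)).mul hw1
  have hds : HasCompactSupport (fun x => (lam * u x - opA α β b c u x) -
      δ * (1 + ‖x‖ ^ 2) ^ (β / 2) * u x) := hfs.sub hgs
  have hhs : HasCompactSupport (fun x => ((lam * u x - opA α β b c u x) -
      δ * (1 + ‖x‖ ^ 2) ^ (β / 2) * u x) * (1 + ‖x‖ ^ 2) ^ (β / 2 * (q - 1))) :=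
    hds.mul_right
  have heps := fun ε hε => aux_eps α β b c q δ lam (β / 2 * (q - 1)) ε hα hβ hq hε hlam hu hs
  obtain ⟨hlimI, hlim⟩ := aux_lim q hq hu0 hhc hhs heps
  have hpt : ∀ x, (((lam * u x - opA α β b c u x) -
    δ * (1 + ‖x‖ ^ 2) ^ (β / 2) * u x) * (1 + ‖x‖ ^ 2) ^ (β / 2 * (q - 1))) *
      (u x * (u x ^ 2) ^ ((q - 2) / 2)) ≤ (2 / δ) ^ (q - 1) * ‖lam * u x - opA α β b c u x‖ ^ q
        - δ / 2 * ‖(1 + ‖x‖ ^ 2) ^ (β / 2) * u x‖ ^ q := by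
    intro x
    refine le_trans ?_ (aux_young δ q _ _ hδ hq (norm_nonneg _) (norm_nonneg _))
    generalize lam * u x - opA α β b c u x = f
    have hp : 0 < (1 + ‖x‖ ^ 2) := by positivity
    rw [Real.rpow_mul hp.le]
    have hW : 0 < (1 + ‖x‖ ^ 2) ^ (β / 2) := by positivity
    generalize (1 + ‖x‖ ^ 2) ^ (β / 2) = W at *
    generalize u x = v
    have hwq : 0 < W ^ (q - 1) := by positivity
    simp only [Real.norm_eq_abs, abs_mul, abs_of_pos hW]
    by_cases hv : v = 0
    · subst hv; simp [hq0.ne', (by linarith : q - 1 ≠ 0)]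
    have hav : 0 < |v| := abs_pos.2 hv
    have e1 : (v ^ 2) ^ ((q - 2) / 2) = |v| ^ (q - 2) := by
      rw [← sq_abs, ← Real.rpow_natCast_mul hav.le]; congr 1; push_cast; ring
    have e2 : |v| ^ (q - 1) = |v| * |v| ^ (q - 2) := by
      rw [← Real.rpow_one_add' hav.le (by linarith)]; congr 1; ring
    have e3 : (W * |v|) ^ q = W * |v| * (W * |v|) ^ (q - 1) := by
      rw [← Real.rpow_one_add' (by positivity) (by linarith)]; congr 1; ring
    rw [e3, Real.mul_rpow hW.le hav.le, e1, e2]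
    have hz : 0 < |v| ^ (q - 2) := by positivity
    generalize |v| ^ (q - 2) = z at *
    generalize W ^ (q - 1) = w at *
    have k1 : f * v ≤ |f| * |v| := by rw [← abs_mul]; exact le_abs_self _
    have k2 : v * v = |v| * |v| := (abs_mul_abs_self v).symm
    calc _ = (f * v) * (w * z) - δ * W * (v * v) * (w * z) := by ring
      _ ≤ (|f| * |v|) * (w * z) - δ * W * (|v| * |v|) * (w * z) := by rw [k2]; gcongr
      _ = _ := by ring
  have hint : 0 ≤ ∫ x, ((2 / δ) ^ (q - 1) * ‖lam * u x - opA α β b c u x‖ ^ q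
        - δ / 2 * ‖(1 + ‖x‖ ^ 2) ^ (β / 2) * u x‖ ^ q) := by
    exact hlim.trans (integral_mono hlimI ((hfi.const_mul _).sub (hgi.const_mul _)) hpt)
  rw [integral_sub (hfi.const_mul _) (hgi.const_mul _), integral_const_mul, integral_const_mul] at hint
  have e : (2 / δ) ^ q = 2 / δ * (2 / δ) ^ (q - 1) := by
    rw [← Real.rpow_one_add' (by positivity) (by linarith)]; congr 1; ring
  rw [e, mul_assoc, div_mul_eq_mul_div, le_div_iff₀ hδ]
  linarith

/-- a priori estimate. For every `1 < p < ∞` there exists `λ0 > 0` such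
that for every `λ ≥ λ0` there is `C = C(λ) > 0` with
`‖ |x|^γ u ‖_p ≤ C ‖λu - Au‖_p` for all `0 ≤ γ ≤ β` and all `u ∈ C_c^∞(ℝ^N)`. -/
theorem stmt6 (N : ℕ) (hN : 2 < N) (α β b c : ℝ) (hα : 2 < α) (hβ : α - 2 < β) (hc : 0 < c)
    (p : ℝ≥0∞) (hp1 : 1 < p) (hp2 : p ≠ ⊤) :
    ∃ lam0 : ℝ, 0 < lam0 ∧ ∀ lam : ℝ, lam0 ≤ lam →
      ∃ C : ℝ≥0, 0 < C ∧ ∀ γ : ℝ, 0 ≤ γ → γ ≤ β →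
        ∀ u : EuclideanSpace ℝ (Fin N) → ℝ, ContDiff ℝ (⊤ : ℕ∞) u → HasCompactSupport u →
          eLpNorm (fun x => ‖x‖ ^ γ * u x) p volume ≤
            (C : ℝ≥0∞) * eLpNorm (fun x => lam * u x - opA α β b c u x) p volume := by
  have hq : 1 < p.toReal := by
    have := (ENNReal.toReal_lt_toReal ENNReal.one_ne_top hp2).2 hp1
    simpa using this
  have hq0 : 0 < p.toReal := by linarith
  have hp0 : p ≠ 0 := (zero_lt_one.trans hp1).ne'
  have hm : 0 < min 1 (p.toReal - 1) := lt_min one_pos (by linarith)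
  have hβ0 : 0 < β := by linarith
  obtain ⟨δ, hδ, lam0, hl0, H⟩ := aux_alg2 (α - 2) β c
    ((2 * (α - b) ^ 2 + 8 * (β / 2 * (p.toReal - 1)) ^ 2) / (4 * min 1 (p.toReal - 1)))
    (by linarith) hβ hc (by positivity)
  refine ⟨lam0, hl0, fun lam hlam => ⟨(2 / δ).toNNReal, ?_, ?_⟩⟩
  · exact Real.toNNReal_pos.2 (div_pos two_pos hδ)
  intro γ hγ0 hγ u hu hs
  have hmain := aux_main α β b c p.toReal δ lam hα hβ0 hq hδ
    (fun r hr => (H r hr).trans (by linarith)) hu hs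
  have hu0 := hu.continuous
  have hw : Continuous (fun x : EuclideanSpace ℝ (Fin N) => (1 + ‖x‖ ^ 2) ^ (β / 2)) := w_cont _
  have hoc := opA_cont α β b c hα hβ0 hu
  have hfc : Continuous (fun x => lam * u x - opA α β b c u x) :=
    (continuous_const.mul hu0).sub hoc
  have hgc : Continuous (fun x => (1 + ‖x‖ ^ 2) ^ (β / 2) * u x) := hw.mul hu0
  have hf := hfc.memLp_of_hasCompactSupport (p := p) (μ := volume) (opA_supp α β b c lam hs)
  have hg := hgc.memLp_of_hasCompactSupport (p := p) (μ := volume) (hs.mul_left)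
  calc eLpNorm (fun x => ‖x‖ ^ γ * u x) p volume
      ≤ eLpNorm (fun x => (1 + ‖x‖ ^ 2) ^ (β / 2) * u x) p volume := by
        refine eLpNorm_mono fun x => ?_
        have g1 : 0 ≤ ‖x‖ ^ γ := by positivity
        have g2 : 0 ≤ (1 + ‖x‖ ^ 2) ^ (β / 2) := by positivity
        rw [norm_mul, norm_mul, Real.norm_of_nonneg g1, Real.norm_of_nonneg g2]
        refine mul_le_mul_of_nonneg_right ?_ (norm_nonneg _)
        have h1 : (1:ℝ) ≤ 1 + ‖x‖ ^ 2 := by nlinarith [sq_nonneg ‖x‖]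
        calc ‖x‖ ^ γ = (‖x‖ ^ 2) ^ (γ / 2) := by
              rw [← Real.rpow_natCast_mul (norm_nonneg _)]; congr 1; push_cast; ring
          _ ≤ (1 + ‖x‖ ^ 2) ^ (γ / 2) :=
              Real.rpow_le_rpow (by positivity) (by linarith) (by linarith)
          _ ≤ _ := Real.rpow_le_rpow_of_exponent_le h1 (by linarith)
    _ ≤ _ := by
        rw [hg.eLpNorm_eq_integral_rpow_norm hp0 hp2, hf.eLpNorm_eq_integral_rpow_norm hp0 hp2]
        have hC : (((2 / δ).toNNReal : ℝ≥0) : ℝ≥0∞) = ENNReal.ofReal (2 / δ) := rfl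
        rw [hC, ← ENNReal.ofReal_mul (by positivity)]
        apply ENNReal.ofReal_le_ofReal
        have hI : 0 ≤ ∫ x, ‖lam * u x - opA α β b c u x‖ ^ p.toReal :=
          integral_nonneg fun x => by positivity
        calc _ ≤ ((2 / δ) ^ p.toReal * ∫ x, ‖lam * u x - opA α β b c u x‖ ^ p.toReal) ^ p.toReal⁻¹ := by
              apply Real.rpow_le_rpow (integral_nonneg fun x => by positivity) hmain (by positivity)
          _ = _ := by
              rw [Real.mul_rpow (by positivity) hI, Real.rpow_rpow_inv (by positivity) hq0.ne']
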